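/- arXiv:2506.13512 — 3 statements merged into one kernel-verified Lean document; each statement's English description precedes it below -/
import Mathlib

section
/- (Real Effros–Winkler separation, finite-dimensional form.) Fix d ≥ 1 and let K be a closed real matrix convex set over ℝ^d. Suppose n ≥ 1 and y ∈ (M_n(ℝ))^d with y ∉ K_n. Then there exist a symmetric matrix γ ∈ M_n(ℝ) and a d-tuple A ∈ (M_n(ℝ))^d such that for every p and every x ∈ K_p one has ℜ⟨x, A⟩ ≤ 1_p ⊗ γ in the Loewner order, while ℜ⟨y, A⟩ ≤ 1_n ⊗ γ fails. Moreover, if 0 ∈ K_1 then one may take γ = 1_n. -/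
open Matrix
open scoped Kronecker

/-- Block-diagonal direct sum of square matrices. -/
def dsum {α : Type*} [Zero α] {m p : ℕ} (A : Matrix (Fin m) (Fin m) α)
    (B : Matrix (Fin p) (Fin p) α) : Matrix (Fin (m + p)) (Fin (m + p)) α :=
  Matrix.reindex finSumFinEquiv finSumFinEquiv (Matrix.fromBlocks A 0 0 B)

/-- A real matrix convex set over `ℝ^d`: a graded family of sets of `d`-tuples of square
real matrices, closed under direct sums and under compressions by real isometries. -/
def IsRealMatrixConvex (d : ℕ) (K : ∀ n : ℕ, Set (Fin d → Matrix (Fin n) (Fin n) ℝ)) : Prop :=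
  (∀ (m p : ℕ) (x : Fin d → Matrix (Fin m) (Fin m) ℝ) (y : Fin d → Matrix (Fin p) (Fin p) ℝ),
    x ∈ K m → y ∈ K p → (fun j => dsum (x j) (y j)) ∈ K (m + p)) ∧
  (∀ (m p : ℕ) (x : Fin d → Matrix (Fin m) (Fin m) ℝ) (β : Matrix (Fin m) (Fin p) ℝ),
    x ∈ K m → βᵀ * β = 1 → (fun j => βᵀ * x j * β) ∈ K p)

/-- `ℜ M = (M + Mᵀ)/2`. -/
noncomputable def reSym {n : Type*} (M : Matrix n n ℝ) : Matrix n n ℝ := (2 : ℝ)⁻¹ • (M + Mᵀ)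

/-- The Loewner order: `A ≤ B` iff `B - A` is positive semidefinite. -/
def loewnerLE {R : Type*} [CommRing R] [PartialOrder R] [StarRing R] {n : Type*} [Fintype n]
    (A B : Matrix n n R) : Prop :=
  (B - A).PosSemidef

/-- `⟨x, A⟩ = Σ_j x_j ⊗ A_j` (Kronecker products). -/
noncomputable def pairing {d m n : ℕ} (x : Fin d → Matrix (Fin m) (Fin m) ℝ)
    (A : Fin d → Matrix (Fin n) (Fin n) ℝ) : Matrix (Fin m × Fin n) (Fin m × Fin n) ℝ :=
  ∑ j, x j ⊗ₖ A j

open scoped MatrixOrder in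
theorem ew_sqrt {n : ℕ} (T : Matrix (Fin n) (Fin n) ℝ) (hT : T.PosSemidef) (hu : IsUnit T.det) :
    ∃ R S : Matrix (Fin n) (Fin n) ℝ, Sᵀ * S = T ∧ R * S = 1 ∧ S * R = 1 := by
  obtain ⟨B, hB⟩ := CStarAlgebra.nonneg_iff_eq_star_mul_self.mp hT.nonneg
  have hB' : Bᵀ * B = T := by rw [hB]; rfl
  have hdet : IsUnit B.det := by
    rw [← hB', det_mul] at hu
    exact isUnit_of_mul_isUnit_right hu
  exact ⟨B⁻¹, B, hB', Matrix.nonsing_inv_mul _ hdet, Matrix.mul_nonsing_inv _ hdet⟩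

theorem ew_vec {p n : ℕ} (x : Matrix (Fin p) (Fin p) ℝ) (A : Matrix (Fin n) (Fin n) ℝ)
    (β : Matrix (Fin p) (Fin n) ℝ) :
    vec βᵀ ⬝ᵥ ((x ⊗ₖ A) *ᵥ vec βᵀ) = trace (Aᵀ * (βᵀ * x * β)) := by
  rw [kronecker_mulVec_vec, vec_dotProduct_vec, ← trace_transpose]
  simp only [transpose_mul, transpose_transpose]
  rw [trace_mul_comm, ← Matrix.mul_assoc, trace_mul_comm, ← Matrix.mul_assoc, trace_mul_comm,
    Matrix.mul_assoc, trace_mul_comm]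
  simp only [Matrix.mul_assoc]
  first | done | (rw [trace_mul_comm]; simp only [Matrix.mul_assoc])

/-- Trace form of the linear matrix inequality. -/
def ewLe {d p n : ℕ} (x : Fin d → Matrix (Fin p) (Fin p) ℝ) (γ : Matrix (Fin n) (Fin n) ℝ)
    (A : Fin d → Matrix (Fin n) (Fin n) ℝ) (β : Matrix (Fin p) (Fin n) ℝ) : Prop :=
  ∑ j, trace ((A j)ᵀ * (βᵀ * x j * β)) ≤ trace (γᵀ * (βᵀ * β))

theorem ew_bridge {d p n : ℕ} (x : Fin d → Matrix (Fin p) (Fin p) ℝ)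
    (γ : Matrix (Fin n) (Fin n) ℝ) (A : Fin d → Matrix (Fin n) (Fin n) ℝ) (hγ : γ.IsSymm) :
    loewnerLE (reSym (pairing x A)) ((1 : Matrix (Fin p) (Fin p) ℝ) ⊗ₖ γ) ↔
      ∀ β : Matrix (Fin p) (Fin n) ℝ, ewLe x γ A β := by
  have key : ∀ β : Matrix (Fin p) (Fin n) ℝ,
      vec βᵀ ⬝ᵥ (((1 : Matrix (Fin p) (Fin p) ℝ) ⊗ₖ γ - reSym (pairing x A)) *ᵥ vec βᵀ) =
        trace (γᵀ * (βᵀ * β)) - ∑ j, trace ((A j)ᵀ * (βᵀ * x j * β)) := by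
    intro β
    have h1 : vec βᵀ ⬝ᵥ (pairing x A *ᵥ vec βᵀ) = ∑ j, trace ((A j)ᵀ * (βᵀ * x j * β)) := by
      simp only [pairing, Matrix.sum_mulVec, dotProduct_sum, ew_vec]
    have h2 : vec βᵀ ⬝ᵥ ((pairing x A)ᵀ *ᵥ vec βᵀ) = vec βᵀ ⬝ᵥ (pairing x A *ᵥ vec βᵀ) := by
      rw [mulVec_transpose, dotProduct_comm, ← dotProduct_mulVec]
    rw [sub_mulVec, dotProduct_sub, ew_vec, Matrix.mul_one, reSym, smul_mulVec, add_mulVec,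
      dotProduct_smul, dotProduct_add, h2, h1, smul_eq_mul]
    ring
  unfold loewnerLE ewLe
  rw [posSemidef_iff_dotProduct_mulVec]
  constructor
  · rintro ⟨-, h⟩ β
    have := h (vec βᵀ)
    rw [star_trivial, key] at this
    linarith
  · intro h
    refine ⟨?_, fun v => ?_⟩
    · have hs : (reSym (pairing x A))ᵀ = reSym (pairing x A) := by
        simp [reSym, add_comm]
      rw [IsHermitian, conjTranspose_eq_transpose_of_trivial, transpose_sub, hs,
        ← kroneckerMap_transpose, transpose_one, hγ.eq]
    · have hv : v = vec (Matrix.of fun i a => v (i, a) : Matrix (Fin p) (Fin n) ℝ)ᵀ := rfl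
      rw [hv, star_trivial, key]
      linarith [h (Matrix.of fun i a => v (i, a))]

theorem ew_riesz {n : ℕ} (g : Matrix (Fin n) (Fin n) ℝ →ₗ[ℝ] ℝ) :
    ∃ G : Matrix (Fin n) (Fin n) ℝ, ∀ T, g T = trace (Gᵀ * T) := by
  refine ⟨Matrix.of fun a b => g (Matrix.single a b 1), fun T => ?_⟩
  conv_lhs => rw [matrix_eq_sum_single T]
  simp only [map_sum, trace, Matrix.diag, Matrix.mul_apply, transpose_apply, of_apply]
  rw [Finset.sum_comm]
  refine Finset.sum_congr rfl fun a _ => Finset.sum_congr rfl fun b _ => ?_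
  have : Matrix.single b a (T b a) = T b a • Matrix.single b a (1 : ℝ) := by simp
  rw [this, map_smul, smul_eq_mul, mul_comm]

/-- The cone generated by `K` at level `n`. -/
def ewCone {d : ℕ} (K : ∀ n : ℕ, Set (Fin d → Matrix (Fin n) (Fin n) ℝ)) (n : ℕ) :
    Set (Matrix (Fin n) (Fin n) ℝ × (Fin d → Matrix (Fin n) (Fin n) ℝ)) :=
  {q | ∃ (m : ℕ) (x : Fin d → Matrix (Fin m) (Fin m) ℝ) (β : Matrix (Fin m) (Fin n) ℝ),
    x ∈ K m ∧ q = (βᵀ * β, fun j => βᵀ * x j * β)}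

theorem ewCone_smul {d : ℕ} {K : ∀ n : ℕ, Set (Fin d → Matrix (Fin n) (Fin n) ℝ)} {n : ℕ}
    {q} (hq : q ∈ ewCone K n) {t : ℝ} (ht : 0 ≤ t) : t • q ∈ ewCone K n := by
  obtain ⟨m, x, β, hx, rfl⟩ := hq
  refine ⟨m, x, Real.sqrt t • β, hx, ?_⟩
  have h : √t * √t = t := Real.mul_self_sqrt ht
  ext1
  · simp [smul_smul, h]
  · funext j
    simp [smul_smul, h]

theorem ewCone_add {d : ℕ} {K : ∀ n : ℕ, Set (Fin d → Matrix (Fin n) (Fin n) ℝ)} {n : ℕ}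
    (hK : IsRealMatrixConvex d K)
    {q r} (hq : q ∈ ewCone K n) (hr : r ∈ ewCone K n) : q + r ∈ ewCone K n := by
  obtain ⟨m, x, β, hx, rfl⟩ := hq
  obtain ⟨p, y, δ, hy, rfl⟩ := hr
  refine ⟨m + p, fun j => dsum (x j) (y j),
    (Matrix.fromRows β δ).submatrix finSumFinEquiv.symm id, hK.1 m p x y hx hy, ?_⟩
  ext1
  · simp only [transpose_submatrix, Prod.fst_add, submatrix_mul_equiv, submatrix_id_id]
    rw [transpose_fromRows, fromCols_mul_fromRows]
  · funext j
    simp only [dsum, reindex_apply, transpose_submatrix, Prod.snd_add, submatrix_mul_equiv,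
      submatrix_id_id, Pi.add_apply]
    rw [transpose_fromRows, fromCols_mul_fromBlocks, fromCols_mul_fromRows]
    simp

theorem ew_compact (n : ℕ) (c : ℝ) :
    IsCompact {R : Matrix (Fin n) (Fin n) ℝ | ∀ a b, R a b ∈ Set.Icc (-c) c} := by
  have : IsCompact (Set.pi Set.univ fun _ : Fin n => Set.pi Set.univ fun _ : Fin n =>
      Set.Icc (-c) c) :=
    isCompact_univ_pi fun _ => isCompact_univ_pi fun _ => isCompact_Icc
  have he : {R : Matrix (Fin n) (Fin n) ℝ | ∀ a b, R a b ∈ Set.Icc (-c) c} =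
      Set.pi Set.univ fun _ : Fin n => Set.pi Set.univ fun _ : Fin n => Set.Icc (-c) c :=
    Set.ext fun R => ⟨fun h a _ b _ => h a b, fun h a b => h a trivial b trivial⟩
  rw [he]
  exact this

theorem ew_notMem {d : ℕ} {K : ∀ n : ℕ, Set (Fin d → Matrix (Fin n) (Fin n) ℝ)} {n : ℕ}
    (hK : IsRealMatrixConvex d K) (hc : IsClosed (K n))
    {y : Fin d → Matrix (Fin n) (Fin n) ℝ} (hy : y ∉ K n) :
    ((1 : Matrix (Fin n) (Fin n) ℝ), y) ∉ closure (ewCone K n) := by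
  intro hmem
  apply hy
  set B := {R : Matrix (Fin n) (Fin n) ℝ | ∀ a b, R a b ∈ Set.Icc (-2 : ℝ) 2}
  have hB : IsCompact B := ew_compact n 2
  have : CompactSpace B := isCompact_iff_compactSpace.mp hB
  let E : Set ((Matrix (Fin n) (Fin n) ℝ × (Fin d → Matrix (Fin n) (Fin n) ℝ)) × B) :=
    {q | (q.2 : Matrix (Fin n) (Fin n) ℝ)ᵀ * q.1.1 * q.2 = 1 ∧
      (fun j => (q.2 : Matrix (Fin n) (Fin n) ℝ)ᵀ * q.1.2 j * q.2) ∈ K n}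
  have hE : IsClosed E := by
    apply IsClosed.inter
    · exact isClosed_eq (by fun_prop) continuous_const
    · exact hc.preimage (by fun_prop)
  have hD : IsClosed (Prod.fst '' E) := isClosedMap_fst_of_compactSpace _ hE
  have hev : ∀ᶠ q : Matrix (Fin n) (Fin n) ℝ × (Fin d → Matrix (Fin n) (Fin n) ℝ) in
      nhds (1, y), q.1.det ≠ 0 ∧ ∀ a, (q.1)⁻¹ a a < 4 := by
    have hfst : Filter.Tendsto (fun q : Matrix (Fin n) (Fin n) ℝ ×
        (Fin d → Matrix (Fin n) (Fin n) ℝ) => q.1) (nhds (1, y)) (nhds 1) :=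
      continuous_fst.tendsto _
    refine hfst.eventually (p := fun T => T.det ≠ 0 ∧ ∀ a, T⁻¹ a a < 4) ?_
    refine Filter.Eventually.and ?_ (Filter.eventually_all.mpr fun a => ?_)
    · have : Continuous fun T : Matrix (Fin n) (Fin n) ℝ => T.det := by fun_prop
      exact this.continuousAt.eventually_ne (by simp)
    · have h1 : ContinuousAt Inv.inv (1 : Matrix (Fin n) (Fin n) ℝ) := by
        apply continuousAt_matrix_inv
        simp only [det_one, Ring.inverse_eq_inv']
        exact continuousAt_inv₀ one_ne_zero
      have h2 : ContinuousAt (fun T : Matrix (Fin n) (Fin n) ℝ => T⁻¹ a a) 1 :=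
        ((continuous_apply_apply a a).continuousAt).comp h1
      exact h2.eventually_lt continuousAt_const (by simp)
  have hfr := (mem_closure_iff_frequently.mp hmem).and_eventually hev
  have hmemD : ((1 : Matrix (Fin n) (Fin n) ℝ), y) ∈ Prod.fst '' E := by
    rw [← hD.closure_eq, mem_closure_iff_frequently]
    refine hfr.mono ?_
    rintro q ⟨⟨m, x, β, hx, rfl⟩, hdet, hlt⟩
    simp only at hdet hlt
    have hps : (βᵀ * β).PosSemidef := by
      have := posSemidef_conjTranspose_mul_self β
      rwa [conjTranspose_eq_transpose_of_trivial] at this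
    obtain ⟨R, S, hS, hRS, hSR⟩ := ew_sqrt _ hps (isUnit_iff_ne_zero.mpr hdet)
    have hRt : Rᵀ * Sᵀ = 1 := by rw [← transpose_mul, hSR, transpose_one]
    have hR1 : Rᵀ * (βᵀ * β) * R = 1 := by
      rw [← hS, ← Matrix.mul_assoc, hRt, Matrix.one_mul, hSR]
    have hinv : (βᵀ * β)⁻¹ = R * Rᵀ := by
      apply Matrix.inv_eq_left_inv
      rw [← hS, Matrix.mul_assoc, ← Matrix.mul_assoc Rᵀ, hRt, Matrix.one_mul, hRS]
    have hRB : R ∈ B := by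
      intro a b
      have h4 := hlt a
      rw [hinv, Matrix.mul_apply] at h4
      simp only [transpose_apply] at h4
      have : R a b * R a b ≤ ∑ k, R a k * R a k :=
        Finset.single_le_sum (f := fun k => R a k * R a k)
          (fun k _ => mul_self_nonneg _) (Finset.mem_univ b)
      constructor <;> nlinarith
    have hxR : (fun j => Rᵀ * (βᵀ * x j * β) * R) ∈ K n := by
     have := hK.2 m n x (β * R) hx (by
      rw [transpose_mul, ← hR1]; simp only [Matrix.mul_assoc])
     simpa only [transpose_mul, Matrix.mul_assoc] using this
    exact ⟨((βᵀ * β, fun j => βᵀ * x j * β), ⟨R, hRB⟩), ⟨hR1, hxR⟩, rfl⟩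
  obtain ⟨⟨_, ⟨R, hR⟩⟩, ⟨h1, h2⟩, rfl⟩ := hmemD
  simp only [Matrix.mul_one] at h1 h2
  have h1' : R * Rᵀ = 1 := mul_eq_one_comm.mp h1
  have := hK.2 n n _ Rᵀ h2 (by rwa [transpose_transpose])
  have he : ∀ j, Rᵀᵀ * (Rᵀ * y j * R) * Rᵀ = y j := fun j => by
    rw [transpose_transpose, Matrix.mul_assoc, Matrix.mul_assoc, h1', Matrix.mul_one,
      ← Matrix.mul_assoc, h1', Matrix.one_mul]
  simpa only [he] using this

/-- Separation in trace form. -/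
theorem ew_sep {d : ℕ} {K : ∀ n : ℕ, Set (Fin d → Matrix (Fin n) (Fin n) ℝ)} {n : ℕ}
    (hK : IsRealMatrixConvex d K) (hc : IsClosed (K n))
    {y : Fin d → Matrix (Fin n) (Fin n) ℝ} (hy : y ∉ K n) (hne : (ewCone K n).Nonempty) :
    ∃ (γ : Matrix (Fin n) (Fin n) ℝ) (A : Fin d → Matrix (Fin n) (Fin n) ℝ), γ.IsSymm ∧
      (∀ (p : ℕ) (x : Fin d → Matrix (Fin p) (Fin p) ℝ), x ∈ K p → ∀ β, ewLe x γ A β) ∧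
      trace γ < ∑ j, trace ((A j)ᵀ * y j) := by
  have : LocallyConvexSpace ℝ (Matrix (Fin n) (Fin n) ℝ) :=
    inferInstanceAs (LocallyConvexSpace ℝ (Fin n → Fin n → ℝ))
  have hconv : Convex ℝ (ewCone K n) := fun q hq r hr a b ha hb _ =>
    ewCone_add hK (ewCone_smul hq ha) (ewCone_smul hr hb)
  obtain ⟨f, u, hf, hu⟩ := geometric_hahn_banach_closed_point hconv.closure isClosed_closure
    (ew_notMem hK hc hy)
  have hf' : ∀ q ∈ ewCone K n, f q < u := fun q hq => hf q (subset_closure hq)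
  have hu0 : 0 < u := by
    obtain ⟨q, hq⟩ := hne
    simpa using hf' _ (ewCone_smul hq le_rfl)
  have hneg : ∀ q ∈ ewCone K n, f q ≤ 0 := by
    intro q hq
    by_contra! hpos
    have := hf' _ (ewCone_smul hq (t := u / f q) (by positivity))
    rw [map_smul, smul_eq_mul, div_mul_cancel₀ _ hpos.ne'] at this
    exact lt_irrefl _ this
  obtain ⟨G, hG⟩ := ew_riesz (f.toLinearMap ∘ₗ LinearMap.inl ℝ _ _)
  have hA : ∀ j : Fin d, ∃ A : Matrix (Fin n) (Fin n) ℝ, ∀ T,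
      f (0, Pi.single j T) = trace (Aᵀ * T) := fun j =>
    ew_riesz (f.toLinearMap ∘ₗ LinearMap.inr ℝ (Matrix (Fin n) (Fin n) ℝ) _ ∘ₗ
      LinearMap.single ℝ (fun _ => Matrix (Fin n) (Fin n) ℝ) j)
  choose A hA using hA
  have hfe : ∀ T z, f (T, z) = trace (Gᵀ * T) + ∑ j, trace ((A j)ᵀ * z j) := by
    intro T z
    have h1 : (T, z) = (T, 0) + ∑ j, ((0 : Matrix (Fin n) (Fin n) ℝ), Pi.single j (z j)) := by
      ext1
      · simp [Prod.fst_sum]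
      · simp [Prod.snd_sum, Finset.univ_sum_single]
    rw [h1, map_add, map_sum]
    congr 1
    · exact hG T
    · exact Finset.sum_congr rfl fun j _ => hA j _
  refine ⟨-(2 : ℝ)⁻¹ • (G + Gᵀ), A, ?_, ?_, ?_⟩
  · simp [IsSymm, add_comm]
  · intro p x hx β
    have h := hneg _ ⟨p, x, β, hx, rfl⟩
    rw [hfe] at h
    have h2 : trace (G * (βᵀ * β)) = trace (Gᵀ * (βᵀ * β)) := by
      rw [← trace_transpose]
      simp only [transpose_mul, transpose_transpose]
      rw [trace_mul_comm]
    unfold ewLe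
    simp only [transpose_smul, transpose_add, transpose_transpose, smul_mul, Matrix.add_mul,
      trace_smul, trace_add, smul_eq_mul, h2]
    linarith
  · have h : 0 < f (1, y) := hu0.trans hu
    rw [hfe] at h
    simp only [trace_smul, trace_add, trace_transpose, smul_eq_mul, Matrix.mul_one] at h ⊢
    linarith

/-- Normalisation in trace form. -/
theorem ew_norm {d : ℕ} {K : ∀ n : ℕ, Set (Fin d → Matrix (Fin n) (Fin n) ℝ)} {n : ℕ}
    {y : Fin d → Matrix (Fin n) (Fin n) ℝ} (h0 : (0 : Fin d → Matrix (Fin 1) (Fin 1) ℝ) ∈ K 1)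
    (γ : Matrix (Fin n) (Fin n) ℝ) (A : Fin d → Matrix (Fin n) (Fin n) ℝ) (hγ : γ.IsSymm)
    (h1 : ∀ (p : ℕ) (x : Fin d → Matrix (Fin p) (Fin p) ℝ), x ∈ K p → ∀ β, ewLe x γ A β)
    (h2 : trace γ < ∑ j, trace ((A j)ᵀ * y j)) :
    ∃ A' : Fin d → Matrix (Fin n) (Fin n) ℝ,
      (∀ (p : ℕ) (x : Fin d → Matrix (Fin p) (Fin p) ℝ), x ∈ K p → ∀ β, ewLe x 1 A' β) ∧
      ∃ β, ¬ ewLe y 1 A' β := by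
  have hps : γ.PosSemidef := by
    refine .of_dotProduct_mulVec_nonneg (by
      rw [IsHermitian, conjTranspose_eq_transpose_of_trivial, hγ.eq]) fun v => ?_
    have := h1 1 0 h0 (replicateRow (Fin 1) v)
    simp only [ewLe, Pi.zero_apply, Matrix.mul_zero, Matrix.zero_mul, trace_zero,
      Finset.sum_const_zero, hγ.eq] at this
    rw [star_trivial]
    refine this.trans_eq ?_
    rw [← Matrix.mul_assoc, trace_mul_comm, transpose_replicateRow]
    simp [trace, Matrix.mul_apply, dotProduct, mulVec]
  obtain ⟨ε, hε, hεn⟩ : ∃ ε : ℝ, 0 < ε ∧ trace γ + ε * n < ∑ j, trace ((A j)ᵀ * y j) := by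
    refine ⟨(∑ j, trace ((A j)ᵀ * y j) - trace γ) / (n + 1), by
      apply div_pos (by linarith); positivity, ?_⟩
    have hn : (0 : ℝ) < n + 1 := by positivity
    have : (∑ j, trace ((A j)ᵀ * y j) - trace γ) / (n + 1) * n <
        ∑ j, trace ((A j)ᵀ * y j) - trace γ := by
      rw [div_mul_eq_mul_div, div_lt_iff₀ hn]
      nlinarith
    linarith
  have hpd : (γ + ε • (1 : Matrix (Fin n) (Fin n) ℝ)).PosDef :=
    Matrix.PosDef.posSemidef_add hps (Matrix.PosDef.one.smul hε)
  obtain ⟨R, S, hS, hRS, hSR⟩ := ew_sqrt _ hpd.posSemidef hpd.det_pos.ne'.isUnit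
  have hRt : Rᵀ * Sᵀ = 1 := by rw [← transpose_mul, hSR, transpose_one]
  have hSt : Sᵀ * Rᵀ = 1 := by rw [← transpose_mul, hRS, transpose_one]
  have tr : ∀ {p : ℕ} (β : Matrix (Fin p) (Fin n) ℝ) (C : Matrix (Fin n) (Fin n) ℝ)
      (x : Matrix (Fin p) (Fin p) ℝ),
      trace ((Rᵀ * C * R)ᵀ * (βᵀ * x * β)) = trace (Cᵀ * ((β * Rᵀ)ᵀ * x * (β * Rᵀ))) := by
    intro p β C x
    simp only [transpose_mul, transpose_transpose, Matrix.mul_assoc]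
    rw [trace_mul_comm]
    simp only [Matrix.mul_assoc]
  have hone : Rᵀ * (γ + ε • (1 : Matrix (Fin n) (Fin n) ℝ)) * R = 1 := by
    rw [← hS, ← Matrix.mul_assoc, hRt, Matrix.one_mul, hSR]
  have tr1 : ∀ {p : ℕ} (β : Matrix (Fin p) (Fin n) ℝ),
      trace ((1 : Matrix (Fin n) (Fin n) ℝ)ᵀ * (βᵀ * β)) =
        trace (γᵀ * ((β * Rᵀ)ᵀ * (β * Rᵀ))) + ε * trace ((β * Rᵀ)ᵀ * (β * Rᵀ)) := by
    intro p β
    have := tr β (γ + ε • (1 : Matrix (Fin n) (Fin n) ℝ)) 1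
    rw [hone] at this
    simp only [Matrix.mul_one] at this
    rw [this]
    simp only [transpose_add, transpose_smul, transpose_one, Matrix.add_mul, smul_mul,
      Matrix.one_mul, trace_add, trace_smul, smul_eq_mul]
  refine ⟨fun j => Rᵀ * A j * R, ?_, Sᵀ, ?_⟩
  · intro p x hx β
    have h := h1 p x hx (β * Rᵀ)
    unfold ewLe at h ⊢
    simp only [tr, tr1]
    have : 0 ≤ trace ((β * Rᵀ)ᵀ * (β * Rᵀ)) := by
      rw [← conjTranspose_eq_transpose_of_trivial]
      exact (posSemidef_conjTranspose_mul_self _).trace_nonneg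
    nlinarith
  · unfold ewLe
    rw [tr1]
    simp only [tr, hSt, transpose_one, Matrix.one_mul, Matrix.mul_one, trace_transpose,
      trace_one, Fintype.card_fin]
    exact not_le.mpr hεn

theorem stmt_9 (d : ℕ) (hd : 1 ≤ d)
    (K : ∀ n : ℕ, Set (Fin d → Matrix (Fin n) (Fin n) ℝ))
    (hK : IsRealMatrixConvex d K) (hclosed : ∀ n, IsClosed (K n))
    (n : ℕ) (hn : 1 ≤ n) (y : Fin d → Matrix (Fin n) (Fin n) ℝ) (hy : y ∉ K n) :
    ∃ (γ : Matrix (Fin n) (Fin n) ℝ) (A : Fin d → Matrix (Fin n) (Fin n) ℝ),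
      γ.IsSymm ∧
      (∀ (p : ℕ) (x : Fin d → Matrix (Fin p) (Fin p) ℝ), x ∈ K p →
        loewnerLE (reSym (pairing x A)) ((1 : Matrix (Fin p) (Fin p) ℝ) ⊗ₖ γ)) ∧
      ¬ loewnerLE (reSym (pairing y A)) ((1 : Matrix (Fin n) (Fin n) ℝ) ⊗ₖ γ) ∧
      ((0 : Fin d → Matrix (Fin 1) (Fin 1) ℝ) ∈ K 1 → γ = 1) := by
  by_cases hne : (ewCone K n).Nonempty
  · obtain ⟨γ, A, hγ, h1, h2⟩ := ew_sep hK (hclosed n) hy hne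
    by_cases h0 : (0 : Fin d → Matrix (Fin 1) (Fin 1) ℝ) ∈ K 1
    · obtain ⟨A', h1', β, hβ⟩ := ew_norm h0 γ A hγ h1 h2
      have hs : (1 : Matrix (Fin n) (Fin n) ℝ).IsSymm := transpose_one
      refine ⟨1, A', hs, fun p x hx => (ew_bridge x 1 A' hs).mpr (h1' p x hx),
        fun h => hβ ((ew_bridge y 1 A' hs).mp h β), fun _ => rfl⟩
    · refine ⟨γ, A, hγ, fun p x hx => (ew_bridge x γ A hγ).mpr (h1 p x hx), fun h => ?_,
        fun h => absurd h h0⟩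
      have := (ew_bridge y γ A hγ).mp h 1
      simp only [ewLe, transpose_one, Matrix.one_mul, Matrix.mul_one, trace_transpose] at this
      exact absurd this (not_le.mpr h2)
  · have hemp : ∀ (p : ℕ) (x : Fin d → Matrix (Fin p) (Fin p) ℝ), x ∉ K p := fun p x hx =>
      hne ⟨_, p, x, 0, hx, rfl⟩
    have hs : (-1 : Matrix (Fin n) (Fin n) ℝ).IsSymm := by simp [IsSymm]
    refine ⟨-1, 0, hs, fun p x hx => absurd hx (hemp p x), fun h => ?_,
      fun h => absurd h (hemp _ _)⟩
    have := (ew_bridge y (-1) 0 hs).mp h 1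
    simp [ewLe] at this
    omega
end

section
/- Fix d, e ≥ 1, let K be a real matrix convex set over ℝ^d and L a real matrix convex set over ℝ^e, and let f : K → L be a real nc affine map. Then there is a unique complex nc affine map f_c : K_c → L_c satisfying (f_c)_n(x + i·0) = f_n(x) + i·0 for all n and all x ∈ K_n; it is given explicitly by (f_c)_n(z) = u_nᴴ · f_{2n}(c(z)) · u_n, where c(z) = (c(z_1), …, c(z_d)) ∈ K_{2n}, the real tuple f_{2n}(c(z)) is viewed as a tuple of complex matrices, and u_n = (1/√2)[1_n; −i·1_n]. Moreover, if every f_n is continuous then every (f_c)_n is continuous. -/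
open Matrix
open scoped Kronecker

/-- A complex matrix convex set over `ℂ^d`. -/
def IsComplexMatrixConvex (d : ℕ) (L : ∀ n : ℕ, Set (Fin d → Matrix (Fin n) (Fin n) ℂ)) : Prop :=
  (∀ (m p : ℕ) (x : Fin d → Matrix (Fin m) (Fin m) ℂ) (y : Fin d → Matrix (Fin p) (Fin p) ℂ),
    x ∈ L m → y ∈ L p → (fun j => dsum (x j) (y j)) ∈ L (m + p)) ∧
  (∀ (m p : ℕ) (x : Fin d → Matrix (Fin m) (Fin m) ℂ) (β : Matrix (Fin m) (Fin p) ℂ),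
    x ∈ L m → βᴴ * β = 1 → (fun j => βᴴ * x j * β) ∈ L p)

/-- The canonical map `c : M_{k,m}(ℂ) → M_{2k,2m}(ℝ)` sending `Z = X + iY` to the real
block matrix `[[X, -Y], [Y, X]]` (indices reindexed to `Fin (k+k)` and `Fin (m+m)`). -/
noncomputable def cmat {k m : ℕ} (Z : Matrix (Fin k) (Fin m) ℂ) :
    Matrix (Fin (k + k)) (Fin (m + m)) ℝ :=
  Matrix.reindex finSumFinEquiv finSumFinEquiv
    (Matrix.fromBlocks (Z.map Complex.re) (-(Z.map Complex.im))
      (Z.map Complex.im) (Z.map Complex.re))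

/-- The complexification of a graded family `K`: at level `n`, the complex tuples `z` with
`(c(z_1), …, c(z_d)) ∈ K_{2n}`. -/
noncomputable def cplxify (d : ℕ) (K : ∀ n : ℕ, Set (Fin d → Matrix (Fin n) (Fin n) ℝ))
    (n : ℕ) : Set (Fin d → Matrix (Fin n) (Fin n) ℂ) :=
  {z | (fun j => cmat (z j)) ∈ K (n + n)}

/-- The isometry `u_n = (1/√2) [1_n ; -i·1_n]` (a block column). -/
noncomputable def uMat (n : ℕ) : Matrix (Fin (n + n)) (Fin n) ℂ :=
  (((Real.sqrt 2 : ℝ) : ℂ))⁻¹ •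
    (Matrix.reindex finSumFinEquiv (Equiv.refl (Fin n))
      (Matrix.fromRows (1 : Matrix (Fin n) (Fin n) ℂ)
        ((-Complex.I) • (1 : Matrix (Fin n) (Fin n) ℂ))))


section helpers

lemma cmat_def' {k m : ℕ} (Z : Matrix (Fin k) (Fin m) ℂ) :
    cmat Z = (Matrix.fromBlocks (Z.map Complex.re) (-(Z.map Complex.im))
      (Z.map Complex.im) (Z.map Complex.re)).submatrix finSumFinEquiv.symm finSumFinEquiv.symm :=
  rfl

lemma map_re_mul {k m l : ℕ} (A : Matrix (Fin k) (Fin m) ℂ) (B : Matrix (Fin m) (Fin l) ℂ) :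
    (A * B).map Complex.re = A.map Complex.re * B.map Complex.re
      - A.map Complex.im * B.map Complex.im := by
  ext i j
  simp [Matrix.mul_apply, Finset.sum_sub_distrib]

lemma map_im_mul {k m l : ℕ} (A : Matrix (Fin k) (Fin m) ℂ) (B : Matrix (Fin m) (Fin l) ℂ) :
    (A * B).map Complex.im = A.map Complex.re * B.map Complex.im
      + A.map Complex.im * B.map Complex.re := by
  ext i j
  simp [Matrix.mul_apply, Finset.sum_add_distrib]

lemma cmat_mul {k m l : ℕ} (A : Matrix (Fin k) (Fin m) ℂ) (B : Matrix (Fin m) (Fin l) ℂ) :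
    cmat (A * B) = cmat A * cmat B := by
  rw [cmat_def', cmat_def', cmat_def', Matrix.submatrix_mul_equiv, Matrix.fromBlocks_multiply,
    map_re_mul, map_im_mul]
  congr 2
  · rw [Matrix.neg_mul, sub_eq_add_neg]
  · rw [Matrix.mul_neg, Matrix.neg_mul, neg_add]
  · rw [add_comm]
  · rw [Matrix.mul_neg, sub_eq_add_neg, add_comm]

lemma cmat_conjTranspose {k m : ℕ} (A : Matrix (Fin k) (Fin m) ℂ) :
    cmat Aᴴ = (cmat A)ᵀ := by
  rw [cmat_def', cmat_def', Matrix.transpose_submatrix, Matrix.fromBlocks_transpose]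
  congr 2
  · ext i j; simp

lemma cmat_one (n : ℕ) : cmat (1 : Matrix (Fin n) (Fin n) ℂ) = 1 := by
  have h1 : (1 : Matrix (Fin n) (Fin n) ℂ).map Complex.re = 1 := by
    ext i j; by_cases h : i = j <;> simp [Matrix.one_apply, h]
  have h2 : (1 : Matrix (Fin n) (Fin n) ℂ).map Complex.im = 0 := by
    ext i j; by_cases h : i = j <;> simp [Matrix.one_apply, h]
  rw [cmat_def', h1, h2, neg_zero, Matrix.fromBlocks_one, Matrix.submatrix_one_equiv]

lemma cmat_injective {k m : ℕ} :
    Function.Injective (cmat : Matrix (Fin k) (Fin m) ℂ → _) := by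
  intro A B h
  unfold cmat at h
  have h := (Matrix.reindex _ _).injective h
  obtain ⟨h1, -, h2, -⟩ := Matrix.fromBlocks_inj.mp h
  ext i j
  exact Complex.ext (congrFun (congrFun h1 i) j) (congrFun (congrFun h2 i) j)

lemma cmat_ofReal {n : ℕ} (x : Matrix (Fin n) (Fin n) ℝ) :
    cmat (x.map Complex.ofReal) = dsum x x := by
  unfold cmat dsum
  congr 2
  ext i j; simp

lemma uMat_conj {n : ℕ} (A B C D : Matrix (Fin n) (Fin n) ℂ) :
    (uMat n)ᴴ * (Matrix.fromBlocks A B C D).submatrix finSumFinEquiv.symm finSumFinEquiv.symm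
      * uMat n
      = (2 : ℂ)⁻¹ • (A + D + Complex.I • (C - B)) := by
  have hu : uMat n = (((Real.sqrt 2 : ℝ) : ℂ))⁻¹ • ((Matrix.fromRows (1 : Matrix (Fin n) (Fin n) ℂ)
        ((-Complex.I) • (1 : Matrix (Fin n) (Fin n) ℂ))).submatrix finSumFinEquiv.symm id) := rfl
  have h2 : (((Real.sqrt 2 : ℝ) : ℂ))⁻¹ * (((Real.sqrt 2 : ℝ) : ℂ))⁻¹ = (2 : ℂ)⁻¹ := by
    rw [← mul_inv, ← Complex.ofReal_mul, Real.mul_self_sqrt (by norm_num)]; norm_num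
  rw [hu, Matrix.conjTranspose_smul, Matrix.conjTranspose_submatrix,
    Matrix.smul_mul, Matrix.smul_mul, Matrix.mul_smul, smul_smul, Matrix.submatrix_mul_equiv,
    Matrix.submatrix_mul_equiv, Matrix.conjTranspose_fromRows_eq_fromCols_conjTranspose,
    Matrix.fromCols_mul_fromBlocks, Matrix.fromCols_mul_fromRows]
  have h3 : star ((((Real.sqrt 2 : ℝ) : ℂ))⁻¹) = (((Real.sqrt 2 : ℝ) : ℂ))⁻¹ := by
    simp
  rw [h3, h2]
  congr 1
  ext i j
  simp [Matrix.add_mul]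
  ring_nf
  simp

lemma uMat_isom (n : ℕ) : (uMat n)ᴴ * uMat n = 1 := by
  have h := uMat_conj (n := n) 1 0 0 1
  rw [Matrix.fromBlocks_one, Matrix.submatrix_one_equiv, Matrix.mul_one] at h
  rw [h]
  ext i j
  simp
  ring

lemma map_sub_blocks {n : ℕ} (A B C D : Matrix (Fin n) (Fin n) ℝ) :
    (((Matrix.fromBlocks A B C D).submatrix finSumFinEquiv.symm finSumFinEquiv.symm :
      Matrix (Fin (n + n)) (Fin (n + n)) ℝ)).map Complex.ofReal =
    (Matrix.fromBlocks (A.map Complex.ofReal) (B.map Complex.ofReal) (C.map Complex.ofReal)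
      (D.map Complex.ofReal)).submatrix finSumFinEquiv.symm finSumFinEquiv.symm := by
  rw [← Matrix.fromBlocks_map]; rfl

lemma uMat_cmat {n : ℕ} (W : Matrix (Fin n) (Fin n) ℂ) :
    (uMat n)ᴴ * (cmat W).map Complex.ofReal * uMat n = W := by
  rw [cmat_def', map_sub_blocks, uMat_conj]
  ext i j
  simp
  conv_rhs => rw [← Complex.re_add_im (W i j)]
  ring

lemma exists_cmat {n : ℕ} (M : Matrix (Fin (n + n)) (Fin (n + n)) ℝ)
    (h : (cmat (Complex.I • (1 : Matrix (Fin n) (Fin n) ℂ)))ᵀ * M *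
      cmat (Complex.I • (1 : Matrix (Fin n) (Fin n) ℂ)) = M) : ∃ W, cmat W = M := by
  have h1 : (Complex.I • (1 : Matrix (Fin n) (Fin n) ℂ)).map Complex.re = 0 := by
    ext i j; by_cases h : i = j <;> simp [Matrix.one_apply, h]
  have h2 : (Complex.I • (1 : Matrix (Fin n) (Fin n) ℂ)).map Complex.im = 1 := by
    ext i j; by_cases h : i = j <;> simp [Matrix.one_apply, h]
  obtain ⟨N, rfl⟩ : ∃ N : Matrix (Fin n ⊕ Fin n) (Fin n ⊕ Fin n) ℝ,
      M = N.submatrix finSumFinEquiv.symm finSumFinEquiv.symm :=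
    ⟨M.submatrix finSumFinEquiv finSumFinEquiv, by ext i j; simp⟩
  obtain ⟨A, B, C, D, rfl⟩ : ∃ A B C D, N = Matrix.fromBlocks A B C D :=
    ⟨_, _, _, _, (Matrix.fromBlocks_toBlocks N).symm⟩
  rw [cmat_def', h1, h2, Matrix.transpose_submatrix, Matrix.submatrix_mul_equiv,
    Matrix.submatrix_mul_equiv] at h
  have h := (Matrix.reindex (finSumFinEquiv (m := n) (n := n))
    (finSumFinEquiv (m := n) (n := n)) (α := ℝ)).injective
    (by simpa only [Matrix.reindex_apply] using h)
  rw [Matrix.fromBlocks_transpose, Matrix.fromBlocks_multiply, Matrix.fromBlocks_multiply] at h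
  obtain ⟨ha, hb, -, -⟩ := Matrix.fromBlocks_inj.mp h
  simp at ha hb
  subst ha
  refine ⟨Matrix.of fun i j => ⟨D i j, C i j⟩, ?_⟩
  rw [cmat_def', ← hb]
  rfl

lemma perm_isom {m p : ℕ} (s : Fin p ≃ Fin m) :
    ((1 : Matrix (Fin m) (Fin m) ℝ).submatrix id s)ᵀ * (1 : Matrix (Fin m) (Fin m) ℝ).submatrix id s
      = 1 := by
  ext i j
  simp [Matrix.mul_apply, Matrix.one_apply, eq_comm]

lemma perm_conj {m p : ℕ} (s : Fin p ≃ Fin m) (A : Matrix (Fin m) (Fin m) ℝ) :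
    ((1 : Matrix (Fin m) (Fin m) ℝ).submatrix id s)ᵀ * A * (1 : Matrix (Fin m) (Fin m) ℝ).submatrix id s
      = A.submatrix s s := by
  ext i j
  simp [Matrix.mul_apply, Matrix.one_apply]

/-- The canonical shuffle. -/
def shuf (m p : ℕ) : Fin ((m + p) + (m + p)) ≃ Fin ((m + m) + (p + p)) :=
  finSumFinEquiv.symm.trans <| (Equiv.sumCongr finSumFinEquiv.symm finSumFinEquiv.symm).trans <|
    (Equiv.sumSumSumComm _ _ _ _).trans <|
    (Equiv.sumCongr finSumFinEquiv finSumFinEquiv).trans finSumFinEquiv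

lemma cmat_dsum {m p : ℕ} (z : Matrix (Fin m) (Fin m) ℂ) (w : Matrix (Fin p) (Fin p) ℂ) :
    cmat (dsum z w) = (dsum (cmat z) (cmat w)).submatrix (shuf m p) (shuf m p) := by
  ext i j
  obtain ⟨i, rfl⟩ := finSumFinEquiv.surjective i
  obtain ⟨j, rfl⟩ := finSumFinEquiv.surjective j
  rcases i with i | i <;> rcases j with j | j <;>
  (obtain ⟨i, rfl⟩ := finSumFinEquiv.surjective i
   obtain ⟨j, rfl⟩ := finSumFinEquiv.surjective j
   simp only [cmat, dsum, shuf, Matrix.reindex_apply, Matrix.submatrix_apply,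
    Equiv.symm_apply_apply, Equiv.trans_apply, Equiv.sumCongr_apply, Sum.map_inl, Sum.map_inr]
   rcases i with i | i <;> rcases j with j | j <;>
   simp [-finSumFinEquiv_apply_left, -finSumFinEquiv_apply_right])

lemma continuous_cmat {n : ℕ} : Continuous (cmat : Matrix (Fin n) (Fin n) ℂ → _) := by
  unfold cmat
  simp only [Matrix.reindex_apply]
  refine Continuous.matrix_submatrix ?_ _ _
  have h1 : Continuous fun Z : Matrix (Fin n) (Fin n) ℂ => Z.map Complex.re :=
    continuous_id.matrix_map Complex.continuous_re
  have h2 : Continuous fun Z : Matrix (Fin n) (Fin n) ℂ => Z.map Complex.im :=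
    continuous_id.matrix_map Complex.continuous_im
  exact h1.matrix_fromBlocks h2.neg h2 h1

end helpers

theorem stmt_13 (d e : ℕ) (hd : 1 ≤ d) (he : 1 ≤ e)
    (K : ∀ n : ℕ, Set (Fin d → Matrix (Fin n) (Fin n) ℝ)) (hK : IsRealMatrixConvex d K)
    (L : ∀ n : ℕ, Set (Fin e → Matrix (Fin n) (Fin n) ℝ)) (hL : IsRealMatrixConvex e L)
    (f : ∀ n : ℕ, (Fin d → Matrix (Fin n) (Fin n) ℝ) → (Fin e → Matrix (Fin n) (Fin n) ℝ))
    -- f is a real nc affine map from K to L: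
    (hfmaps : ∀ (n : ℕ) (x : Fin d → Matrix (Fin n) (Fin n) ℝ), x ∈ K n → f n x ∈ L n)
    (hfdsum : ∀ (m p : ℕ) (x : Fin d → Matrix (Fin m) (Fin m) ℝ)
        (y : Fin d → Matrix (Fin p) (Fin p) ℝ), x ∈ K m → y ∈ K p →
      f (m + p) (fun j => dsum (x j) (y j)) = fun j => dsum (f m x j) (f p y j))
    (hfcompr : ∀ (m p : ℕ) (x : Fin d → Matrix (Fin m) (Fin m) ℝ)
        (β : Matrix (Fin m) (Fin p) ℝ), x ∈ K m → βᵀ * β = 1 →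
      f p (fun j => βᵀ * x j * β) = fun j => βᵀ * f m x j * β) :
    ∃ fc : ∀ n : ℕ, (Fin d → Matrix (Fin n) (Fin n) ℂ) → (Fin e → Matrix (Fin n) (Fin n) ℂ),
      -- fc is a complex nc affine map from K_c to L_c:
      (∀ (n : ℕ) (z : Fin d → Matrix (Fin n) (Fin n) ℂ), z ∈ cplxify d K n →
        fc n z ∈ cplxify e L n) ∧
      (∀ (m p : ℕ) (z : Fin d → Matrix (Fin m) (Fin m) ℂ)
          (w : Fin d → Matrix (Fin p) (Fin p) ℂ), z ∈ cplxify d K m → w ∈ cplxify d K p →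
        fc (m + p) (fun j => dsum (z j) (w j)) = fun j => dsum (fc m z j) (fc p w j)) ∧
      (∀ (m p : ℕ) (z : Fin d → Matrix (Fin m) (Fin m) ℂ)
          (β : Matrix (Fin m) (Fin p) ℂ), z ∈ cplxify d K m → βᴴ * β = 1 →
        fc p (fun j => βᴴ * z j * β) = fun j => βᴴ * fc m z j * β) ∧
      -- fc extends f:
      (∀ (n : ℕ) (x : Fin d → Matrix (Fin n) (Fin n) ℝ), x ∈ K n →
        fc n (fun j => (x j).map Complex.ofReal) = fun j => (f n x j).map Complex.ofReal) ∧
      -- the explicit formula: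
      (∀ (n : ℕ) (z : Fin d → Matrix (Fin n) (Fin n) ℂ), z ∈ cplxify d K n →
        fc n z = fun j =>
          (uMat n)ᴴ * (f (n + n) (fun j' => cmat (z j')) j).map Complex.ofReal * uMat n) ∧
      -- continuity:
      ((∀ n, ContinuousOn (f n) (K n)) → ∀ n, ContinuousOn (fc n) (cplxify d K n)) ∧
      -- uniqueness:
      (∀ gc : ∀ n : ℕ, (Fin d → Matrix (Fin n) (Fin n) ℂ) → (Fin e → Matrix (Fin n) (Fin n) ℂ),
        (∀ (n : ℕ) (z : Fin d → Matrix (Fin n) (Fin n) ℂ), z ∈ cplxify d K n →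
          gc n z ∈ cplxify e L n) →
        (∀ (m p : ℕ) (z : Fin d → Matrix (Fin m) (Fin m) ℂ)
            (w : Fin d → Matrix (Fin p) (Fin p) ℂ), z ∈ cplxify d K m → w ∈ cplxify d K p →
          gc (m + p) (fun j => dsum (z j) (w j)) = fun j => dsum (gc m z j) (gc p w j)) →
        (∀ (m p : ℕ) (z : Fin d → Matrix (Fin m) (Fin m) ℂ)
            (β : Matrix (Fin m) (Fin p) ℂ), z ∈ cplxify d K m → βᴴ * β = 1 →
          gc p (fun j => βᴴ * z j * β) = fun j => βᴴ * gc m z j * β) →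
        (∀ (n : ℕ) (x : Fin d → Matrix (Fin n) (Fin n) ℝ), x ∈ K n →
          gc n (fun j => (x j).map Complex.ofReal) = fun j => (f n x j).map Complex.ofReal) →
        ∀ (n : ℕ) (z : Fin d → Matrix (Fin n) (Fin n) ℂ), z ∈ cplxify d K n →
          gc n z = fc n z) := by
  have key : ∀ (n : ℕ) (z : Fin d → Matrix (Fin n) (Fin n) ℂ), z ∈ cplxify d K n → ∀ j,
      cmat ((uMat n)ᴴ * (f (n + n) (fun j' => cmat (z j')) j).map Complex.ofReal * uMat n)
        = f (n + n) (fun j' => cmat (z j')) j := by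
    intro n z hz j
    have hI : (Complex.I • (1 : Matrix (Fin n) (Fin n) ℂ))ᴴ * Complex.I • 1 = 1 := by
      simp [Matrix.conjTranspose_smul, smul_smul]
    have hiso : (cmat (Complex.I • (1 : Matrix (Fin n) (Fin n) ℂ)))ᵀ *
        cmat (Complex.I • (1 : Matrix (Fin n) (Fin n) ℂ)) = 1 := by
      rw [← cmat_conjTranspose, ← cmat_mul, hI, cmat_one]
    have h := congrFun (hfcompr (n + n) (n + n) (fun j' => cmat (z j')) _ hz hiso) j
    have h' : (fun j' => (cmat (Complex.I • (1 : Matrix (Fin n) (Fin n) ℂ)))ᵀ * cmat (z j') *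
        cmat (Complex.I • (1 : Matrix (Fin n) (Fin n) ℂ))) = fun j' => cmat (z j') := by
      funext j'
      rw [← cmat_conjTranspose, ← cmat_mul, ← cmat_mul]
      congr 1
      simp [Matrix.conjTranspose_smul, smul_smul]
    rw [h'] at h
    obtain ⟨W, hW⟩ := exists_cmat _ h.symm
    rw [← hW, uMat_cmat]
  have hreal : ∀ (n : ℕ) (x : Fin d → Matrix (Fin n) (Fin n) ℝ), x ∈ K n →
      (fun j => (x j).map Complex.ofReal) ∈ cplxify d K n := by
    intro n x hx
    change (fun j => cmat ((x j).map Complex.ofReal)) ∈ K (n + n)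
    simp only [cmat_ofReal]
    exact hK.1 n n x x hx hx
  refine ⟨fun n z j => (uMat n)ᴴ * (f (n + n) (fun j' => cmat (z j')) j).map Complex.ofReal
    * uMat n, ?_, ?_, ?_, ?_, ?_, ?_, ?_⟩
  · intro n z hz
    change (fun j => cmat _) ∈ L (n + n)
    simp only [key n z hz]
    exact hfmaps _ _ hz
  · intro m p z w hz hw
    have e1 : (fun j => cmat (dsum (z j) (w j))) = fun j =>
        ((1 : Matrix (Fin ((m + m) + (p + p))) (Fin ((m + m) + (p + p))) ℝ).submatrix id
          (shuf m p))ᵀ * dsum (cmat (z j)) (cmat (w j)) *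
        (1 : Matrix (Fin ((m + m) + (p + p))) (Fin ((m + m) + (p + p))) ℝ).submatrix id
          (shuf m p) := by
      funext j
      rw [perm_conj, cmat_dsum]
    have hmem := hK.1 _ _ _ _ hz hw
    have hzw : (fun j => dsum (z j) (w j)) ∈ cplxify d K (m + p) := by
      change (fun j => cmat (dsum (z j) (w j))) ∈ K _
      rw [e1]
      exact hK.2 _ _ _ _ hmem (perm_isom _)
    funext j
    apply cmat_injective
    have hk := key _ _ hzw j
    refine hk.trans ?_
    rw [cmat_dsum, key m z hz, key p w hw, e1,
      hfcompr _ _ (fun j => dsum (cmat (z j)) (cmat (w j))) _ hmem (perm_isom _),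
      hfdsum _ _ (fun j => cmat (z j)) (fun j => cmat (w j)) hz hw]
    exact perm_conj _ _
  · intro m p z β hz hβ
    have hiso : (cmat β)ᵀ * cmat β = 1 := by
      rw [← cmat_conjTranspose, ← cmat_mul, hβ, cmat_one]
    have e1 : (fun j => cmat (βᴴ * z j * β)) = fun j => (cmat β)ᵀ * cmat (z j) * cmat β := by
      funext j
      rw [cmat_mul, cmat_mul, cmat_conjTranspose]
    have hc : (fun j => βᴴ * z j * β) ∈ cplxify d K p := by
      change (fun j => cmat (βᴴ * z j * β)) ∈ K _
      rw [e1]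
      exact hK.2 _ _ _ _ hz hiso
    funext j
    apply cmat_injective
    refine (key _ _ hc j).trans ?_
    rw [cmat_mul, cmat_mul, cmat_conjTranspose, key m z hz, e1,
      hfcompr _ _ (fun j => cmat (z j)) _ hz hiso]
  · intro n x hx
    funext j
    simp only [cmat_ofReal]
    rw [hfdsum n n x x hx hx]
    simp only [← cmat_ofReal]
    rw [uMat_cmat]
  · intro n z hz
    rfl
  · intro hf n
    refine continuousOn_pi.mpr fun j => ?_
    have hc : Continuous fun z : Fin d → Matrix (Fin n) (Fin n) ℂ => fun j' => cmat (z j') :=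
      continuous_pi fun j' => continuous_cmat.comp (continuous_apply j')
    have h1 : ContinuousOn (fun z : Fin d → Matrix (Fin n) (Fin n) ℂ =>
        f (n + n) (fun j' => cmat (z j')) j) (cplxify d K n) :=
      (continuous_apply j).comp_continuousOn ((hf (n + n)).comp hc.continuousOn fun z hz => hz)
    have h2 : Continuous fun M : Matrix (Fin (n + n)) (Fin (n + n)) ℝ =>
        (uMat n)ᴴ * M.map Complex.ofReal * uMat n :=
      (continuous_const.matrix_mul
        (continuous_id.matrix_map Complex.continuous_ofReal)).matrix_mul continuous_const
    exact h2.comp_continuousOn h1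
  · intro gc _ _ hgcompr hgext n z hz
    have h := hgcompr (n + n) n (fun j => (cmat (z j)).map Complex.ofReal) (uMat n)
      (hreal _ _ hz) (uMat_isom n)
    simp only [uMat_cmat] at h
    rw [hgext _ (fun j => cmat (z j)) hz] at h
    exact h
end

section
/- Let K ⊆ ℝ^d be a nonempty compact convex set. For n ≥ 1 let Min(K)_n be the set of all d-tuples of the form (Σ_{j=1}^m (k_j)_1 · v_jᵀv_j, …, Σ_{j=1}^m (k_j)_d · v_jᵀv_j), where m ∈ ℕ, k_1, …, k_m ∈ K and v_1, …, v_m ∈ M_{1,n}(ℝ) are row vectors with Σ_{j=1}^m v_jᵀv_j = 1_n. Then: (a) each Min(K)_n is a compact convex subset of (M_n(ℝ))^d; (b) the family (Min(K)_n)_{n≥1} is a real matrix convex set over ℝ^d whose first level Min(K)_1 equals K; (c) it is minimal with this property: for every real matrix convex set L over ℝ^d with K ⊆ L_1, one has Min(K)_n ⊆ L_n for all n. -/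
open Matrix
open scoped Kronecker

/-- The embedding of `ℝ^d` as `d`-tuples of `1×1` real matrices (the first level). -/
def iota1 {d : ℕ} (x : Fin d → ℝ) : Fin d → Matrix (Fin 1) (Fin 1) ℝ :=
  fun i => Matrix.of fun _ _ => x i

/-- `Min(K)_n`: all tuples `(Σ_j (k_j)_1 vⱼᵀvⱼ, …, Σ_j (k_j)_d vⱼᵀvⱼ)` with `k_j ∈ K` and
row vectors `v_j ∈ M_{1,n}(ℝ)` satisfying `Σ_j vⱼᵀvⱼ = 1_n`. -/
def minK {d : ℕ} (K : Set (Fin d → ℝ)) (n : ℕ) :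
    Set (Fin d → Matrix (Fin n) (Fin n) ℝ) :=
  {X | ∃ (m : ℕ) (k : Fin m → Fin d → ℝ) (v : Fin m → Matrix (Fin 1) (Fin n) ℝ),
    (∀ j, k j ∈ K) ∧ (∑ j, (v j)ᵀ * v j) = 1 ∧
    X = fun i => ∑ j, k j i • ((v j)ᵀ * v j)}

theorem aux_compact_hull {E : Type*} [AddCommGroup E] [Module ℝ E] [TopologicalSpace E]
    [ContinuousAdd E] [ContinuousSMul ℝ E] [FiniteDimensional ℝ E] {s : Set E}
    (hs : IsCompact s) : IsCompact (convexHull ℝ s) := by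
  have key : convexHull ℝ s = ⋃ m : Fin (Module.finrank ℝ E + 2),
      (fun p : (Fin m → ℝ) × (Fin m → E) => ∑ i, p.1 i • p.2 i) ''
        (stdSimplex ℝ (Fin m) ×ˢ Set.univ.pi (fun _ => s)) := by
    ext x
    constructor
    · intro hx
      obtain ⟨ι, _, z, w, hz, hai, hw, hw1, hx⟩ := eq_pos_convex_span_of_mem_convexHull hx
      have hc : Fintype.card ι ≤ Module.finrank ℝ E + 1 :=
        (hai.card_le_finrank_succ).trans (Nat.succ_le_succ (Submodule.finrank_le _))
      let e := (Fintype.equivFin ι).symm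
      rw [Set.mem_iUnion]
      refine ⟨⟨Fintype.card ι, by omega⟩, (w ∘ e, z ∘ e), ⟨⟨fun i => (hw _).le, ?_⟩, ?_⟩, ?_⟩
      · simpa using (e.sum_comp w).trans hw1
      · intro i _
        exact hz ⟨_, rfl⟩
      · exact (e.sum_comp (fun i => w i • z i)).trans hx
    · rw [Set.mem_iUnion]
      rintro ⟨m, ⟨w, z⟩, ⟨⟨h0, h1⟩, h2⟩, rfl⟩
      exact mem_convexHull_of_exists_fintype w z h0 h1 (fun i => h2 i trivial) rfl
  rw [key]
  refine isCompact_iUnion fun m => ((isCompact_stdSimplex ℝ _).prod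
    (isCompact_univ_pi fun _ => hs)).image ?_
  fun_prop

theorem aux_mem {d n : ℕ} {K : Set (Fin d → ℝ)} {ι : Type*} [Fintype ι]
    (k : ι → Fin d → ℝ) (v : ι → Matrix (Fin 1) (Fin n) ℝ)
    (hk : ∀ j, k j ∈ K) (hv : (∑ j, (v j)ᵀ * v j) = 1)
    (X : Fin d → Matrix (Fin n) (Fin n) ℝ) (hX : ∀ i, X i = ∑ j, k j i • ((v j)ᵀ * v j)) :
    X ∈ minK K n := by
  let e := (Fintype.equivFin ι).symm
  refine ⟨Fintype.card ι, k ∘ e, v ∘ e, fun j => hk _, ?_, ?_⟩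
  · exact (e.sum_comp (fun j => (v j)ᵀ * v j)).trans hv
  · funext i
    rw [hX]
    exact (e.sum_comp (fun j => k j i • ((v j)ᵀ * v j))).symm

theorem aux_convex {d n : ℕ} (K : Set (Fin d → ℝ)) : Convex ℝ (minK K n) := by
  rintro X ⟨m, k, v, hk, hv, rfl⟩ Y ⟨p, l, w, hl, hw, rfl⟩ a b ha hb hab
  have ea := Real.mul_self_sqrt ha
  have eb := Real.mul_self_sqrt hb
  refine aux_mem (ι := Fin m ⊕ Fin p) (Sum.elim k l)
    (Sum.elim (fun j => √a • v j) (fun j => √b • w j)) ?_ ?_ _ ?_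
  · rintro (j | j)
    exacts [hk j, hl j]
  · simp only [Fintype.sum_sum_type, Sum.elim_inl, Sum.elim_inr, Matrix.transpose_smul,
      Matrix.smul_mul, Matrix.mul_smul, smul_smul, ea, eb, ← Finset.smul_sum, hv, hw, ← add_smul,
      hab, one_smul]
  · intro i
    simp only [Fintype.sum_sum_type, Sum.elim_inl, Sum.elim_inr, Matrix.transpose_smul,
      Matrix.smul_mul, Matrix.mul_smul, smul_smul, ea, eb, Pi.add_apply, Pi.smul_apply,
      Finset.smul_sum, mul_comm]

theorem aux_compress {d m p : ℕ} (K : Set (Fin d → ℝ)) (x : Fin d → Matrix (Fin m) (Fin m) ℝ)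
    (β : Matrix (Fin m) (Fin p) ℝ) (hx : x ∈ minK K m) (hβ : βᵀ * β = 1) :
    (fun j => βᵀ * x j * β) ∈ minK K p := by
  obtain ⟨r, k, v, hk, hv, rfl⟩ := hx
  have e : ∀ j, (v j * β)ᵀ * (v j * β) = βᵀ * ((v j)ᵀ * v j) * β := by
    intro j
    simp only [Matrix.transpose_mul, Matrix.mul_assoc]
  refine ⟨r, k, fun j => v j * β, hk, ?_, ?_⟩
  · simp only [e, ← Matrix.sum_mul, ← Matrix.mul_sum, hv, Matrix.mul_one, hβ]
  · funext i
    simp only [e, Matrix.sum_mul, Matrix.mul_sum, Matrix.mul_smul, Matrix.smul_mul]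

theorem aux_dsum {d m p : ℕ} (K : Set (Fin d → ℝ)) (x : Fin d → Matrix (Fin m) (Fin m) ℝ)
    (y : Fin d → Matrix (Fin p) (Fin p) ℝ) (hx : x ∈ minK K m) (hy : y ∈ minK K p) :
    (fun j => dsum (x j) (y j)) ∈ minK K (m + p) := by
  obtain ⟨r, k, v, hk, hv, rfl⟩ := hx
  obtain ⟨s, l, w, hl, hw, rfl⟩ := hy
  have hv' := fun a b => congrFun (congrFun hv a) b
  have hw' := fun a b => congrFun (congrFun hw a) b
  simp only [Matrix.sum_apply, Matrix.mul_apply, Matrix.transpose_apply, Finset.univ_unique,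
    Finset.sum_singleton] at hv' hw'
  refine aux_mem (ι := Fin r ⊕ Fin s) (Sum.elim k l)
    (Sum.elim (fun j => Matrix.of fun a b => Fin.addCases (fun b => v j a b) (fun _ => 0) b)
      (fun j => Matrix.of fun a b => Fin.addCases (fun _ => 0) (fun b => w j a b) b)) ?_ ?_ _ ?_
  · rintro (j | j)
    exacts [hk j, hl j]
  · ext a b
    refine Fin.addCases (fun a => ?_) (fun a => ?_) a <;>
    refine Fin.addCases (fun b => ?_) (fun b => ?_) b
    · simpa [Matrix.sum_apply, Matrix.mul_apply, Matrix.one_apply, Fin.ext_iff] using hv' a b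
    · simp [Matrix.sum_apply, Matrix.mul_apply, Matrix.one_apply, Fin.ext_iff]
      omega
    · simp [Matrix.sum_apply, Matrix.mul_apply, Matrix.one_apply, Fin.ext_iff]
      omega
    · simpa [Matrix.sum_apply, Matrix.mul_apply, Matrix.one_apply, Fin.ext_iff] using hw' a b
  · intro i
    ext a b
    refine Fin.addCases (fun a => ?_) (fun a => ?_) a <;>
    refine Fin.addCases (fun b => ?_) (fun b => ?_) b <;>
    simp [dsum, Matrix.sum_apply, Matrix.mul_apply]

theorem aux_one {d : ℕ} (K : Set (Fin d → ℝ)) (hconv : Convex ℝ K) :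
    minK K 1 = iota1 '' K := by
  ext X
  constructor
  · rintro ⟨r, k, v, hk, hv, rfl⟩
    have hv' := congrFun (congrFun hv 0) 0
    simp [Matrix.sum_apply, Matrix.mul_apply] at hv'
    refine ⟨∑ j, (v j 0 0 * v j 0 0) • k j,
      hconv.sum_mem (fun _ _ => mul_self_nonneg _) hv' (fun j _ => hk j), ?_⟩
    funext i
    ext a b
    obtain rfl := Subsingleton.elim a 0
    obtain rfl := Subsingleton.elim b 0
    simp [iota1, Matrix.sum_apply, Matrix.mul_apply, mul_comm]
  · rintro ⟨x, hx, rfl⟩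
    refine ⟨1, fun _ => x, fun _ => 1, fun _ => hx, by simp, ?_⟩
    funext i
    ext a b
    obtain rfl := Subsingleton.elim a 0
    obtain rfl := Subsingleton.elim b 0
    simp [iota1]

theorem aux_minimal {d : ℕ} (K : Set (Fin d → ℝ)) (hne : K.Nonempty)
    (L : ∀ n : ℕ, Set (Fin d → Matrix (Fin n) (Fin n) ℝ)) (hL : IsRealMatrixConvex d L)
    (hK : ∀ x ∈ K, iota1 x ∈ L 1) (n : ℕ) : minK K n ⊆ L n := by
  have hdiag : ∀ (m : ℕ) (k : Fin m → Fin d → ℝ), (∀ j, k j ∈ K) →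
      (fun i => Matrix.diagonal fun j => k j i) ∈ L m := by
    intro m
    induction m with
    | zero =>
      intro k _
      obtain ⟨x, hx⟩ := hne
      convert hL.2 1 0 _ (0 : Matrix (Fin 1) (Fin 0) ℝ) (hK x hx) (Subsingleton.elim _ _) using 1
      funext i
      exact Subsingleton.elim _ _
    | succ m ih =>
      intro k hk
      convert hL.1 m 1 _ _ (ih (fun j => k j.castSucc) fun j => hk _) (hK _ (hk (Fin.last m)))
        using 1
      funext i
      ext a b
      refine Fin.addCases (fun a => ?_) (fun a => ?_) a <;>
      refine Fin.addCases (fun b => ?_) (fun b => ?_) b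
      · simp [dsum, Matrix.diagonal_apply, Fin.ext_iff]
        rfl
      · simp [dsum, Matrix.diagonal_apply, Fin.ext_iff]
        omega
      · simp [dsum, Matrix.diagonal_apply, Fin.ext_iff]
        omega
      · obtain rfl := Subsingleton.elim a 0
        obtain rfl := Subsingleton.elim b 0
        simp [dsum, Matrix.diagonal_apply, iota1]
        rfl
  rintro X ⟨m, k, v, hk, hv, rfl⟩
  have hv' := fun a b => congrFun (congrFun hv a) b
  simp only [Matrix.sum_apply, Matrix.mul_apply, Matrix.transpose_apply, Finset.univ_unique,
    Finset.sum_singleton] at hv'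
  convert hL.2 m n _ (Matrix.of fun j b => v j 0 b) (hdiag m k hk) ?_ using 1
  · funext i
    ext a b
    simp [Matrix.sum_apply, Matrix.mul_apply, Matrix.diagonal_apply]
    exact Finset.sum_congr rfl fun j _ => by ring
  · ext a b
    simpa [Matrix.mul_apply] using hv' a b

/-- The compact generating set for the compactness proof. -/
def auxGen {d : ℕ} (K : Set (Fin d → ℝ)) (n : ℕ) :
    Set (Matrix (Fin n) (Fin n) ℝ × (Fin d → Matrix (Fin n) (Fin n) ℝ)) :=
  (fun p : (Fin d → ℝ) × Matrix (Fin 1) (Fin n) ℝ =>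
    (p.2ᵀ * p.2, fun i => p.1 i • (p.2ᵀ * p.2))) ''
    (K ×ˢ {v : Matrix (Fin 1) (Fin n) ℝ | ∑ b, v 0 b * v 0 b = 1})

theorem aux_sphere (n : ℕ) :
    IsCompact {v : Matrix (Fin 1) (Fin n) ℝ | ∑ b, v 0 b * v 0 b = 1} := by
  have h1 : IsCompact (Set.univ.pi fun _ : Fin 1 => Set.univ.pi fun _ : Fin n =>
      Set.Icc (-1 : ℝ) 1) :=
    isCompact_univ_pi fun _ => isCompact_univ_pi fun _ => isCompact_Icc
  refine IsCompact.of_isClosed_subset (X := Fin 1 → Fin n → ℝ) h1 ?_ ?_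
  · refine isClosed_eq (X := ℝ) (Y := Fin 1 → Fin n → ℝ) ?_ continuous_const
    fun_prop
  · intro v hv a _ b _
    obtain rfl := Subsingleton.elim a 0
    have h2 : v 0 b * v 0 b ≤ 1 := by
      rw [← show ∑ b, v 0 b * v 0 b = 1 from hv]
      exact Finset.single_le_sum (f := fun b => v 0 b * v 0 b)
        (fun _ _ => mul_self_nonneg _) (Finset.mem_univ b)
    constructor <;> nlinarith

theorem aux_gen_compact {d : ℕ} (K : Set (Fin d → ℝ)) (hK : IsCompact K) (n : ℕ) :
    IsCompact (auxGen K n) := by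
  refine (hK.prod (aux_sphere n)).image ?_
  fun_prop

theorem aux_normalize {d n : ℕ} (hn : 1 ≤ n) (K : Set (Fin d → ℝ)) (k : Fin d → ℝ) (hk : k ∈ K)
    (v : Matrix (Fin 1) (Fin n) ℝ) : ∃ c ∈ auxGen K n,
      (∑ b, v 0 b * v 0 b) • c = (vᵀ * v, fun i => k i • (vᵀ * v)) := by
  have h0 : 0 ≤ ∑ b, v 0 b * v 0 b := Finset.sum_nonneg fun _ _ => mul_self_nonneg _
  rcases h0.eq_or_lt with h | h
  · have hz : v = 0 := by
      ext a b
      obtain rfl := Subsingleton.elim a 0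
      have := (Finset.sum_eq_zero_iff_of_nonneg (fun b _ => mul_self_nonneg (v 0 b))).1 h.symm b
        (Finset.mem_univ b)
      simpa using this
    refine ⟨_, ⟨(k, Matrix.of fun _ b => if b = ⟨0, hn⟩ then 1 else 0), ⟨hk, ?_⟩, rfl⟩, ?_⟩
    · simp
    · rw [← h, zero_smul, hz]
      simp
      rfl
  · set t := ∑ b, v 0 b * v 0 b with ht
    have es : √t * √t = t := Real.mul_self_sqrt h0
    have et : (√t)⁻¹ * (√t)⁻¹ = t⁻¹ := by rw [← mul_inv, es]
    refine ⟨_, ⟨(k, (√t)⁻¹ • v), ⟨hk, ?_⟩, rfl⟩, ?_⟩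
    · have : ∀ b, ((√t)⁻¹ * v 0 b) * ((√t)⁻¹ * v 0 b) = t⁻¹ * (v 0 b * v 0 b) := by
        intro b
        rw [← et]
        ring
      simp only [Set.mem_ofPred_eq, Matrix.smul_apply, smul_eq_mul, this, ← Finset.mul_sum, ← ht]
      exact inv_mul_cancel₀ h.ne'
    · have e2 : ((√t)⁻¹ • v)ᵀ * ((√t)⁻¹ • v) = t⁻¹ • (vᵀ * v) := by
        simp only [Matrix.transpose_smul, Matrix.smul_mul, Matrix.mul_smul, smul_smul, et]
      simp only [e2, Prod.smul_mk]
      ext1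
      · simp [smul_smul, h.ne']
      · funext i
        simp only [Pi.smul_apply, smul_smul]
        congr 1
        field_simp

theorem aux_compact {d n : ℕ} (hn : 1 ≤ n) (K : Set (Fin d → ℝ)) (hK : IsCompact K) :
    IsCompact (minK K n) := by
  have hn0 : (n : ℝ) ≠ 0 := by positivity
  have hH : IsCompact (convexHull ℝ (auxGen K n)) := aux_compact_hull (aux_gen_compact K hK n)
  have key : minK K n = (fun p : Matrix (Fin n) (Fin n) ℝ × (Fin d → Matrix (Fin n) (Fin n) ℝ) =>
      (n : ℝ) • p.2) '' (convexHull ℝ (auxGen K n) ∩ {p | p.1 = (n : ℝ)⁻¹ • 1}) := by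
    ext X
    constructor
    · rintro ⟨m, k, v, hk, hv, rfl⟩
      choose c hc hcv using fun j => aux_normalize hn K (k j) (hk j) (v j)
      have htr : ∑ j, ∑ b, v j 0 b * v j 0 b = n := by
        have := congrArg Matrix.trace hv
        rw [Matrix.trace_one, Fintype.card_fin] at this
        rw [← this, Finset.sum_comm]
        simp [Matrix.trace, Matrix.sum_apply, Matrix.mul_apply]
      have hsum : ∑ j, ((n : ℝ)⁻¹ * ∑ b, v j 0 b * v j 0 b) • c j =
          (n : ℝ)⁻¹ • ((1 : Matrix (Fin n) (Fin n) ℝ),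
            fun i => ∑ j, k j i • ((v j)ᵀ * v j)) := by
        simp only [← smul_smul, hcv, ← Finset.smul_sum]
        congr 1
        ext1
        · rw [Prod.fst_sum]
          exact hv
        · rw [Prod.snd_sum]
          funext i
          simp
      refine ⟨_, ⟨mem_convexHull_of_exists_fintype _ c ?_ ?_ hc hsum, ?_⟩, ?_⟩
      · intro j
        exact mul_nonneg (by positivity) (Finset.sum_nonneg fun _ _ => mul_self_nonneg _)
      · rw [← Finset.mul_sum, htr, inv_mul_cancel₀ hn0]
      · rfl
      · simp only [Prod.smul_snd]
        rw [smul_smul, mul_inv_cancel₀ hn0, one_smul]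
    · rintro ⟨p, ⟨hp, hp1⟩, rfl⟩
      obtain ⟨ι, _, w, z, hw, hw1, hz, rfl⟩ := mem_convexHull_iff_exists_fintype.1 hp
      choose q hq hqz using hz
      have es : ∀ j, √(n * w j) * √(n * w j) = n * w j := fun j =>
        Real.mul_self_sqrt (mul_nonneg (by positivity) (hw j))
      refine aux_mem (fun j => (q j).1) (fun j => √(n * w j) • (q j).2) (fun j => (hq j).1) ?_ _ ?_
      · simp only [Matrix.transpose_smul, Matrix.smul_mul, Matrix.mul_smul, smul_smul, es]
        simp only [Set.mem_ofPred_eq, Prod.fst_sum, Prod.smul_fst, ← hqz] at hp1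
        simp only [← smul_smul, ← Finset.smul_sum, hp1]
        rw [smul_smul, mul_inv_cancel₀ hn0, one_smul]
      · intro i
        simp only [Matrix.transpose_smul, Matrix.smul_mul, Matrix.mul_smul, smul_smul, es]
        simp only [Prod.snd_sum, Prod.smul_snd, ← hqz, Pi.smul_apply, Finset.sum_apply,
          Finset.smul_sum, smul_smul]
        exact Finset.sum_congr rfl fun j _ => by congr 1; ring
  rw [key]
  refine (hH.inter_right (isClosed_eq continuous_fst continuous_const)).image ?_
  fun_prop

theorem stmt_14 (d : ℕ) (hd : 1 ≤ d) (K : Set (Fin d → ℝ))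
    (hne : K.Nonempty) (hcomp : IsCompact K) (hconv : Convex ℝ K) :
    -- (a)
    (∀ n : ℕ, 1 ≤ n → IsCompact (minK K n) ∧ Convex ℝ (minK K n)) ∧
    -- (b)
    IsRealMatrixConvex d (minK K) ∧ minK K 1 = iota1 '' K ∧
    -- (c)
    (∀ L : ∀ n : ℕ, Set (Fin d → Matrix (Fin n) (Fin n) ℝ), IsRealMatrixConvex d L →
      (∀ x ∈ K, iota1 x ∈ L 1) → ∀ n : ℕ, minK K n ⊆ L n) := by
  refine ⟨fun n hn => ⟨aux_compact hn K hcomp, aux_convex K⟩,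
    ⟨fun m p x y hx hy => aux_dsum K x y hx hy, fun m p x β hx hβ => aux_compress K x β hx hβ⟩,
    aux_one K hconv, fun L hL hK n => aux_minimal K hne L hL hK n⟩
end
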